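/- Let x ∈ R^{d−1} with dual Diophantine type strictly less than d (d ≥ 2), and let ψ : N → R^+ be nonincreasing with ∑_{q∈N} ψ(q)^d = ∞. Then for Lebesgue-almost every y ∈ R, there exist infinitely many q ∈ N with ‖q(x,y)‖ < ψ(q), i.e., the line {x} × R ⊆ R^d is of Khintchine type for divergence. -/

import Mathlib

open scoped Classical ENNReal
open MeasureTheory Filter

/-- Sup-norm distance from `x ∈ ℝ^ℓ` to the nearest integer point of `ℤ^ℓ`. -/
noncomputable def distInt {l : ℕ} (x : Fin l → ℝ) : ℝ :=
  ⨅ p : Fin l → ℤ, ‖x - fun i => (p i : ℝ)‖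

/-- Distance from `t ∈ ℝ` to the nearest integer. -/
noncomputable def distZ (t : ℝ) : ℝ := ⨅ p : ℤ, |t - (p : ℝ)|

/-- The dual Diophantine type of `x ∈ ℝ^ℓ`, valued in `ℝ≥0∞`. -/
noncomputable def tauD {l : ℕ} (x : Fin l → ℝ) : ℝ≥0∞ :=
  ⨆ τ ∈ {τ : ℝ | 0 < τ ∧
    {n : Fin l → ℤ | n ≠ 0 ∧
      distZ (∑ i, (n i : ℝ) * x i) < ‖fun i => ((n i : ℝ))‖ ^ (-τ)}.Infinite},
    ENNReal.ofReal τ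


/-- Every coordinate of `q x` is within `δ` of an integer. -/
def Nr {l : ℕ} (x : Fin l → ℝ) (q : ℕ) (δ : ℝ) : Prop := ∀ i, ∃ p : ℤ, |(q : ℝ) * x i - p| < δ

lemma distZ_le (t : ℝ) (p : ℤ) : distZ t ≤ |t - p| :=
  ciInf_le ⟨0, by rintro _ ⟨p, rfl⟩; positivity⟩ p

lemma distZ_nonneg (t : ℝ) : 0 ≤ distZ t := le_ciInf fun _ => abs_nonneg _

lemma distZ_eq_zero {t : ℝ} (h : distZ t = 0) : ∃ p : ℤ, t = p := by
  refine ⟨round t, ?_⟩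
  have : |t - round t| ≤ distZ t := le_ciInf fun p => round_le t p
  rw [h] at this
  have := abs_nonpos_iff.1 this
  linarith

lemma norm_int_ge {l : ℕ} {n : Fin l → ℤ} (h : n ≠ 0) : 1 ≤ ‖fun i => ((n i : ℝ))‖ := by
  obtain ⟨i, hi⟩ := Function.ne_iff.1 h
  have h1 : ‖(n i : ℝ)‖ ≤ ‖fun i => ((n i : ℝ))‖ := norm_le_pi_norm (fun i => ((n i : ℝ))) i
  have h2 : (1 : ℝ) ≤ ‖(n i : ℝ)‖ := by
    rw [Real.norm_eq_abs]
    exact_mod_cast Int.one_le_abs hi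
  linarith

lemma finite_pos {α : Type*} {F : Set α} (hF : F.Finite) (f : α → ℝ) (hf : ∀ a ∈ F, 0 < f a) :
    ∃ c : ℝ, 0 < c ∧ c ≤ 1 ∧ ∀ a ∈ F, c ≤ f a := by
  induction F, hF using Set.Finite.induction_on with
  | empty => exact ⟨1, by norm_num, le_rfl, by simp⟩
  | @insert a s _ _ ih =>
    obtain ⟨c, hc, hc1, h⟩ := ih fun b hb => hf b (Set.mem_insert_of_mem _ hb)
    refine ⟨min c (f a), lt_min hc (hf a (Set.mem_insert _ _)), (min_le_left _ _).trans hc1, ?_⟩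
    rintro b (rfl | hb)
    · exact min_le_right _ _
    · exact (min_le_left _ _).trans (h b hb)

lemma type_bound (l : ℕ) (x : Fin l → ℝ) (h : tauD x < ((l + 1 : ℕ) : ℝ≥0∞)) :
    ∃ τ c : ℝ, 0 < τ ∧ (l : ℝ) ≤ τ ∧ τ < l + 1 ∧ 0 < c ∧ c ≤ 1 ∧
      ∀ (K : ℕ) (m : Fin l → ℤ), m ≠ 0 → (∀ i, |m i| ≤ K) → ∀ p : ℤ,
        c * (K : ℝ) ^ (-τ) ≤ |(∑ i, (m i : ℝ) * x i) - p| := by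
  have hlt : max (tauD x).toReal l < (l + 1 : ℝ) := by
    apply max_lt _ (by linarith)
    have := ENNReal.toReal_strict_mono (by simp) h
    rw [ENNReal.toReal_natCast] at this
    push_cast at this
    exact this
  obtain ⟨τ, h1, h2⟩ := exists_between hlt
  have ht0 : (tauD x).toReal < τ := (le_max_left _ _).trans_lt h1
  have htl : (l : ℝ) < τ := (le_max_right _ _).trans_lt h1
  have hτ : 0 < τ := (Nat.cast_nonneg l).trans_lt htl
  have hfin : {n : Fin l → ℤ | n ≠ 0 ∧
      distZ (∑ i, (n i : ℝ) * x i) < ‖fun i => ((n i : ℝ))‖ ^ (-τ)}.Finite := by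
    by_contra hinf
    have : ENNReal.ofReal τ ≤ tauD x := by
      unfold tauD
      exact le_iSup₂_of_le τ ⟨hτ, hinf⟩ le_rfl
    have h3 := ENNReal.toReal_mono (h.trans (by simp)).ne this
    rw [ENNReal.toReal_ofReal hτ.le] at h3
    linarith
  have hpos : ∀ n ∈ {n : Fin l → ℤ | n ≠ 0 ∧
      distZ (∑ i, (n i : ℝ) * x i) < ‖fun i => ((n i : ℝ))‖ ^ (-τ)},
      0 < distZ (∑ i, (n i : ℝ) * x i) := by
    rintro n ⟨hn, -⟩
    refine lt_of_le_of_ne (distZ_nonneg _) fun h0 => ?_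
    obtain ⟨p, hp⟩ := distZ_eq_zero h0.symm
    apply Set.infinite_of_injective_forall_mem (f := fun j : ℕ => ((j : ℤ) + 1) • n) _ _ hfin
    · intro a b hab
      obtain ⟨i, hi⟩ := Function.ne_iff.1 hn
      have := congrFun hab i
      simp only [Pi.smul_apply, smul_eq_mul] at this
      have := mul_right_cancel₀ hi this
      omega
    · intro j
      have hne : ((j : ℤ) + 1) • n ≠ 0 := smul_ne_zero (by omega) hn
      refine ⟨hne, ?_⟩
      have h1 := norm_int_ge hne
      refine lt_of_le_of_lt ?_ (Real.rpow_pos_of_pos (by linarith) _)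
      refine (distZ_le _ (((j : ℤ) + 1) * p)).trans (le_of_eq ?_)
      rw [abs_eq_zero]
      push_cast
      rw [← hp, Finset.mul_sum, sub_eq_zero]
      apply Finset.sum_congr rfl
      intro i _
      simp [mul_assoc]
  obtain ⟨c, hc, hc1, hcF⟩ := finite_pos hfin _ hpos
  refine ⟨τ, c, hτ, htl.le, h2, hc, hc1, fun K m hm hK p => ?_⟩
  have hn1 := norm_int_ge hm
  have hnK : ‖fun i => ((m i : ℝ))‖ ≤ K := by
    rw [pi_norm_le_iff_of_nonneg (by positivity)]
    intro i
    rw [Real.norm_eq_abs]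
    exact_mod_cast hK i
  have hKp : (K : ℝ) ^ (-τ) ≤ ‖fun i => ((m i : ℝ))‖ ^ (-τ) :=
    Real.rpow_le_rpow_of_nonpos (by linarith) hnK (by linarith)
  have hK1 : (K : ℝ) ^ (-τ) ≤ 1 := hKp.trans (Real.rpow_le_one_of_one_le_of_nonpos hn1 (by linarith))
  have hK0 : 0 ≤ (K : ℝ) ^ (-τ) := by positivity
  refine le_trans ?_ (distZ_le _ p)
  by_cases hmem : distZ (∑ i, (m i : ℝ) * x i) < ‖fun i => ((m i : ℝ))‖ ^ (-τ)
  · have := hcF m ⟨hm, hmem⟩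
    nlinarith
  · push Not at hmem
    nlinarith

lemma cos_int (a : ℤ) : ∫ θ in (-1 : ℝ)..2, Real.cos (2 * Real.pi * a * θ) =
    if a = 0 then 3 else 0 := by
  split_ifs with h
  · subst h; norm_num
  · have h2 : (2 * Real.pi * a : ℝ) ≠ 0 := by
      have : (a : ℝ) ≠ 0 := by exact_mod_cast h
      positivity
    rw [intervalIntegral.integral_comp_mul_left (fun t => Real.cos t) h2, integral_cos]
    have e1 : (2 * Real.pi * a * 2 : ℝ) = ((2 * a : ℤ) : ℝ) * (2 * Real.pi) - 0 := by push_cast; ring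
    have e2 : (2 * Real.pi * a * (-1) : ℝ) = ((-a : ℤ) : ℝ) * (2 * Real.pi) - 0 := by push_cast; ring
    rw [e1, e2, Real.sin_int_mul_two_pi_sub, Real.sin_int_mul_two_pi_sub]
    simp

lemma cos_sq_int (A : Finset ℕ) (hA : ∀ q ∈ A, 1 ≤ q) :
    ∫ θ in (-1 : ℝ)..2, (∑ q ∈ A, Real.cos (2 * Real.pi * q * θ)) ^ 2 = 3 / 2 * A.card := by
  have h1 : ∀ θ : ℝ, (∑ q ∈ A, Real.cos (2 * Real.pi * q * θ)) ^ 2 =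
      ∑ q ∈ A, ∑ r ∈ A, (Real.cos (2 * Real.pi * ((q : ℤ) - r : ℤ) * θ) / 2 +
        Real.cos (2 * Real.pi * ((q : ℤ) + r : ℤ) * θ) / 2) := by
    intro θ
    rw [sq, Finset.sum_mul_sum]
    refine Finset.sum_congr rfl fun q _ => Finset.sum_congr rfl fun r _ => ?_
    have e1 : 2 * Real.pi * ((q : ℤ) - r : ℤ) * θ = 2 * Real.pi * q * θ - 2 * Real.pi * r * θ := by
      push_cast; ring
    have e2 : 2 * Real.pi * ((q : ℤ) + r : ℤ) * θ = 2 * Real.pi * q * θ + 2 * Real.pi * r * θ := by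
      push_cast; ring
    rw [e1, e2, Real.cos_add, Real.cos_sub]; ring
  simp_rw [h1]
  rw [intervalIntegral.integral_finsetSum fun q _ => Continuous.intervalIntegrable (by fun_prop) _ _]
  have h2 : ∀ q ∈ A, ∫ θ in (-1 : ℝ)..2, ∑ r ∈ A,
      (Real.cos (2 * Real.pi * ((q : ℤ) - r : ℤ) * θ) / 2 +
        Real.cos (2 * Real.pi * ((q : ℤ) + r : ℤ) * θ) / 2) = 3 / 2 := by
    intro q hq
    rw [intervalIntegral.integral_finsetSum fun q _ => Continuous.intervalIntegrable (by fun_prop) _ _]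
    have h3 : ∀ r ∈ A, ∫ θ in (-1 : ℝ)..2,
      (Real.cos (2 * Real.pi * ((q : ℤ) - r : ℤ) * θ) / 2 +
        Real.cos (2 * Real.pi * ((q : ℤ) + r : ℤ) * θ) / 2) = if r = q then 3 / 2 else 0 := by
      intro r hr
      rw [intervalIntegral.integral_add (Continuous.intervalIntegrable (by fun_prop) _ _)
        (Continuous.intervalIntegrable (by fun_prop) _ _), intervalIntegral.integral_div,
        intervalIntegral.integral_div, cos_int, cos_int]
      have := hA q hq
      have := hA r hr
      rw [if_neg (show ¬ ((q : ℤ) + r = 0) by omega)]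
      by_cases h : r = q
      · subst h; norm_num
      · rw [if_neg h, if_neg (by omega)]; norm_num
    rw [Finset.sum_congr rfl h3]
    simp [hq]
  rw [Finset.sum_congr rfl h2]
  simp [mul_comm]

lemma cos_ge_half {u : ℝ} (P : ℤ) (h : |u - P| ≤ 1 / 6) : 1 / 2 ≤ Real.cos (2 * Real.pi * u) := by
  have e : 2 * Real.pi * u = 2 * Real.pi * (u - P) + P * (2 * Real.pi) := by ring
  rw [e, Real.cos_add_int_mul_two_pi, ← Real.cos_abs, ← Real.cos_pi_div_three]
  have hp := Real.pi_pos
  apply Real.cos_le_cos_of_nonneg_of_le_pi (abs_nonneg _) (by linarith)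
  rw [abs_mul, abs_of_pos (by positivity : (0 : ℝ) < 2 * Real.pi)]
  nlinarith

lemma count_core {l : ℕ} (x : Fin l → ℝ) (Q K : ℕ) (hQ : 1 ≤ Q) (δ : ℝ)
    (hK : l * K * δ ≤ 1 / 12)
    (sep : ∀ m : Fin l → ℤ, m ≠ 0 → (∀ i, |m i| ≤ K) → ∀ p : ℤ,
      1 / (6 * Q : ℝ) ≤ |(∑ i, (m i : ℝ) * x i) - p|) :
    (((Finset.Icc 1 Q).filter fun q => Nr x q δ).card : ℝ) * (K : ℝ) ^ l ≤ 36 * Q := by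
  set A := (Finset.Icc 1 Q).filter fun q => Nr x q δ with hAdef
  have hQ0 : (0 : ℝ) < Q := by exact_mod_cast hQ
  set S : ℝ → ℝ := fun θ => ∑ q ∈ A, Real.cos (2 * Real.pi * q * θ) with hS
  have hSc : Continuous fun θ => S θ ^ 2 := by simp only [hS]; fun_prop
  set r : ℝ := 1 / (12 * Q) with hr
  have hr0 : 0 < r := by positivity
  have hQr : Q * r = 1 / 12 := by rw [hr]; field_simp
  have hr12 : r ≤ 1 / 12 := by
    have : (1 : ℝ) ≤ Q := by exact_mod_cast hQ
    nlinarith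
  let θ : (Fin l → Fin K) → ℝ := fun n => Int.fract (∑ i, ((n i : ℕ) : ℝ) * x i)
  let B : (Fin l → Fin K) → Set ℝ := fun n => Set.Ioo (θ n - r) (θ n + r)
  have hBsub : ∀ n, B n ⊆ Set.Ioc (-1) 2 := by
    intro n t ht
    have h1 := Int.fract_nonneg (∑ i, ((n i : ℕ) : ℝ) * x i)
    have h2 := Int.fract_lt_one (∑ i, ((n i : ℕ) : ℝ) * x i)
    change θ n - r < t ∧ t < θ n + r at ht
    change 0 ≤ θ n at h1
    change θ n < 1 at h2
    constructor <;> linarith [ht.1, ht.2]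
  have hdisj : Pairwise (Function.onFun Disjoint B) := by
    intro n m hnm
    refine Set.disjoint_left.2 fun t hn hm => ?_
    have hlt : |θ n - θ m| < 1 / (6 * Q : ℝ) := by
      have : 1 / (6 * Q : ℝ) = 2 * r := by rw [hr]; field_simp; norm_num
      rw [this, abs_lt]
      change θ n - r < t ∧ t < θ n + r at hn
      change θ m - r < t ∧ t < θ m + r at hm
      constructor <;> linarith [hn.1, hn.2, hm.1, hm.2]
    have := sep (fun i => (n i : ℤ) - (m i : ℤ)) ?_ ?_
      (⌊∑ i, ((n i : ℕ) : ℝ) * x i⌋ - ⌊∑ i, ((m i : ℕ) : ℝ) * x i⌋)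
    · have e : (∑ i, (((n i : ℤ) - (m i : ℤ) : ℤ) : ℝ) * x i) -
        ((⌊∑ i, ((n i : ℕ) : ℝ) * x i⌋ - ⌊∑ i, ((m i : ℕ) : ℝ) * x i⌋ : ℤ) : ℝ) = θ n - θ m := by
        simp only [θ, Int.fract]
        push_cast
        simp only [sub_mul, Finset.sum_sub_distrib]
        ring
      rw [e] at this
      linarith
    · obtain ⟨i, hi⟩ := Function.ne_iff.1 hnm
      refine Function.ne_iff.2 ⟨i, ?_⟩
      have : (n i : ℕ) ≠ m i := fun h => hi (Fin.ext h)
      simp only [Pi.zero_apply]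
      omega
    · intro i
      have := (n i).2
      have := (m i).2
      rw [abs_le]; constructor <;> omega
  have hlow : ∀ n, ∀ t ∈ B n, (A.card : ℝ) ^ 2 / 4 ≤ S t ^ 2 := by
    intro n t ht
    have hS2 : (A.card : ℝ) / 2 ≤ S t := by
      have : ∑ q ∈ A, (1 / 2 : ℝ) ≤ S t := by
        apply Finset.sum_le_sum
        intro q hq
        rw [hAdef, Finset.mem_filter, Finset.mem_Icc] at hq
        obtain ⟨⟨hq1, hqQ⟩, hnr⟩ := hq
        choose p hp using hnr
        rw [mul_assoc]
        refine cos_ge_half ((∑ i, (n i : ℤ) * p i) - q * ⌊∑ i, ((n i : ℕ) : ℝ) * x i⌋) ?_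
        have e : q * t - (((∑ i, (n i : ℤ) * p i) - q * ⌊∑ i, ((n i : ℕ) : ℝ) * x i⌋ : ℤ) : ℝ) =
          q * (t - θ n) + ∑ i, ((n i : ℕ) : ℝ) * (q * x i - p i) := by
          simp only [θ, Int.fract, mul_sub, Finset.sum_sub_distrib, Finset.mul_sum]
          push_cast
          have : ∑ i, (q : ℝ) * (((n i : ℕ) : ℝ) * x i) = ∑ i, ((n i : ℕ) : ℝ) * (q * x i) :=
            Finset.sum_congr rfl fun i _ => by ring
          rw [this]
          ring
        rw [e]
        have b1 : |q * (t - θ n)| ≤ 1 / 12 := by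
          rw [abs_mul, Nat.abs_cast, ← hQr]
          apply mul_le_mul (by exact_mod_cast hqQ) _ (abs_nonneg _) hQ0.le
          rw [abs_le]
          change θ n - r < t ∧ t < θ n + r at ht
          constructor <;> linarith [ht.1, ht.2]
        have b2 : |∑ i, ((n i : ℕ) : ℝ) * (q * x i - p i)| ≤ 1 / 12 := by
          refine (Finset.abs_sum_le_sum_abs _ _).trans (le_trans ?_ hK)
          have : ∀ i ∈ Finset.univ, |((n i : ℕ) : ℝ) * (q * x i - p i)| ≤ K * δ := by
            intro i _
            rw [abs_mul, Nat.abs_cast]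
            exact mul_le_mul (by exact_mod_cast (n i).2.le) (hp i).le (abs_nonneg _) (by positivity)
          refine (Finset.sum_le_sum this).trans (le_of_eq ?_)
          simp [mul_assoc]
        refine (abs_add_le _ _).trans ?_
        linarith
      simpa [div_eq_mul_inv] using this
    have : (0 : ℝ) ≤ A.card := by positivity
    nlinarith
  have hint : IntegrableOn (fun θ => S θ ^ 2) (Set.Ioc (-1) 2) :=
    (hSc.integrableOn_Icc (a := -1) (b := 2)).mono_set Set.Ioc_subset_Icc_self
  have h1 : ∑ n, ∫ t in B n, S t ^ 2 = ∫ t in ⋃ n, B n, S t ^ 2 :=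
    (integral_iUnion_fintype (fun n => measurableSet_Ioo) hdisj
      (fun n => hint.mono_set (hBsub n))).symm
  have h2 : ∫ t in ⋃ n, B n, S t ^ 2 ≤ ∫ t in Set.Ioc (-1) 2, S t ^ 2 :=
    setIntegral_mono_set hint (ae_of_all _ fun t => sq_nonneg _)
      (LE.le.eventuallyLE (Set.iUnion_subset hBsub))
  have h3 : ∫ t in Set.Ioc (-1) 2, S t ^ 2 = 3 / 2 * A.card := by
    rw [← intervalIntegral.integral_of_le (by norm_num)]
    exact cos_sq_int A fun q hq => by
      rw [hAdef, Finset.mem_filter, Finset.mem_Icc] at hq; exact hq.1.1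
  have h4 : ∀ n ∈ Finset.univ, (A.card : ℝ) ^ 2 / 4 * (2 * r) ≤ ∫ t in B n, S t ^ 2 := by
    intro n _
    have := setIntegral_ge_of_const_le_real (μ := volume) (measurableSet_Ioo (a := θ n - r) (b := θ n + r))
      (by simp) (hlow n) (hint.mono_set (hBsub n))
    have e : volume.real (B n) = 2 * r := by
      simp only [B]
      rw [Real.volume_real_Ioo_of_le (by linarith)]; ring
    change _ * volume.real (B n) ≤ _ at this
    rwa [e] at this
  have h5 := Finset.sum_le_sum h4
  rw [h1] at h5
  simp only [Finset.sum_const, Finset.card_univ, Fintype.card_fun, Fintype.card_fin, nsmul_eq_mul,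
    Nat.cast_pow] at h5
  have h6 := (h5.trans h2).trans h3.le
  rcases Nat.eq_zero_or_pos A.card with h0 | h0
  · rw [h0]; simp
  · have h0' : (0 : ℝ) < A.card := by exact_mod_cast h0
    have h7 : A.card * ((K : ℝ) ^ l * A.card * (r / 2)) ≤ A.card * (3 / 2) := by nlinarith
    have h8 := le_of_mul_le_mul_left h7 h0'
    have h9 : (K : ℝ) ^ l * A.card * (Q * r) ≤ 3 * Q := by nlinarith
    rw [hQr] at h9
    linarith

lemma count_le {l : ℕ} (hl : 1 ≤ l) (x : Fin l → ℝ) (τ c : ℝ) (hτ : 0 < τ) (hc : 0 < c)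
    (H : ∀ (K : ℕ) (m : Fin l → ℤ), m ≠ 0 → (∀ i, |m i| ≤ K) → ∀ p : ℤ,
        c * (K : ℝ) ^ (-τ) ≤ |(∑ i, (m i : ℝ) * x i) - p|) :
    ∃ C : ℝ, 0 < C ∧ ∀ (Q : ℕ) (δ : ℝ), 1 ≤ Q → 0 < δ → 1 ≤ 6 * c * Q * δ ^ τ →
      (((Finset.Icc 1 Q).filter fun q => Nr x q δ).card : ℝ) ≤ C * Q * δ ^ l := by
  have hl0 : (1 : ℝ) ≤ l := by exact_mod_cast hl
  refine ⟨36 * (24 * l) ^ l, by positivity, fun Q δ hQ hδ h1 => ?_⟩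
  have hQ0 : (0 : ℝ) < Q := by exact_mod_cast hQ
  rcases le_or_gt (12 * l * δ) 1 with h | h
  · set K := ⌊1 / (12 * l * δ)⌋₊ with hK
    have hpos : 0 < 12 * l * δ := by positivity
    have hu1 : 1 ≤ 1 / (12 * l * δ) := by rw [le_div_iff₀ hpos]; linarith
    have hK1 : 1 ≤ K := Nat.le_floor (by simpa using hu1)
    have hK1' : (1 : ℝ) ≤ K := by exact_mod_cast hK1
    have hKle : (K : ℝ) ≤ 1 / (12 * l * δ) := Nat.floor_le (by positivity)
    have hKlt : 1 / (12 * l * δ) < K + 1 := Nat.lt_floor_add_one _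
    have hKle' : K * (12 * l * δ) ≤ 1 := by rwa [le_div_iff₀ hpos] at hKle
    have hKd : (K : ℝ) ≤ δ⁻¹ := by
      rw [← one_div, le_div_iff₀ hδ]
      have : (K : ℝ) * δ ≤ K * δ * (12 * l) := le_mul_of_one_le_right (by positivity) (by linarith)
      linarith
    have hkey := count_core x Q K hQ δ (by linarith) (by
      intro m hm hmK p
      refine le_trans ?_ (H K m hm hmK p)
      have h2 : δ ^ τ ≤ (K : ℝ) ^ (-τ) := by
        have := Real.rpow_le_rpow_of_nonpos (z := -τ) (by linarith) hKd (by linarith)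
        rwa [Real.inv_rpow hδ.le, Real.rpow_neg hδ.le, inv_inv] at this
      rw [div_le_iff₀ (by positivity)]
      have : c * δ ^ τ * (6 * Q) ≤ c * (K : ℝ) ^ (-τ) * (6 * Q) := by gcongr
      linarith)
    have h3 : 1 ≤ 24 * l * δ * K := by
      rw [div_lt_iff₀ hpos] at hKlt
      nlinarith
    have h4 : 1 ≤ (24 * l * δ * K) ^ l := one_le_pow₀ h3
    set N := (((Finset.Icc 1 Q).filter fun q => Nr x q δ).card : ℝ)
    have hN : 0 ≤ N := by positivity
    calc N ≤ N * (24 * l * δ * K) ^ l := le_mul_of_one_le_right hN h4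
      _ = (N * (K : ℝ) ^ l) * (24 * l * δ) ^ l := by rw [mul_pow]; ring
      _ ≤ (36 * Q) * (24 * l * δ) ^ l := by gcongr
      _ = _ := by rw [mul_pow]; ring
  · have h2 : (((Finset.Icc 1 Q).filter fun q => Nr x q δ).card : ℝ) ≤ Q := by
      have := Finset.card_filter_le (Finset.Icc 1 Q) fun q => Nr x q δ
      rw [Nat.card_Icc] at this
      exact_mod_cast this
    have h3 : 1 ≤ (24 * l * δ) ^ l := one_le_pow₀ (by linarith)
    rw [mul_pow] at h3
    have : 36 * (24 * l) ^ l * Q * δ ^ l = Q * (36 * ((24 * l : ℝ) ^ l * δ ^ l)) := by ring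
    rw [this]
    refine h2.trans (le_mul_of_one_le_right hQ0.le (by linarith))

lemma cell_lt (a : ℕ) (ha : 0 < a) (t : ℝ) : ⌊a * Int.fract t⌋₊ < a := by
  have h0 : (0 : ℝ) < a := by exact_mod_cast ha
  rw [Nat.floor_lt (by have := Int.fract_nonneg t; positivity)]
  have := Int.fract_lt_one t
  nlinarith

lemma cell_eq (a : ℕ) (δ : ℝ) (ha : 1 ≤ a * δ) (ha0 : 0 < a) (s t : ℝ)
    (h : ⌊a * Int.fract s⌋₊ = ⌊a * Int.fract t⌋₊) :
    ∃ p : ℤ, |t - s - p| < δ := by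
  have h0 : (0 : ℝ) < a := by exact_mod_cast ha0
  refine ⟨⌊t⌋ - ⌊s⌋, ?_⟩
  have e : t - s - ((⌊t⌋ - ⌊s⌋ : ℤ) : ℝ) = Int.fract t - Int.fract s := by
    simp only [Int.fract]; push_cast; ring
  rw [e]
  have hs0 := Int.fract_nonneg s
  have ht0 := Int.fract_nonneg t
  have a1 := Nat.floor_le (a := a * Int.fract s) (by positivity)
  have a2 := Nat.floor_le (a := a * Int.fract t) (by positivity)
  have a3 := Nat.lt_floor_add_one (a * Int.fract s)
  have a4 := Nat.lt_floor_add_one (a * Int.fract t)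
  rw [h] at a1 a3
  have : a * |Int.fract t - Int.fract s| < a * δ := by
    refine lt_of_lt_of_le ?_ ha
    rw [← Nat.abs_cast a, ← abs_mul, abs_lt]
    constructor <;> nlinarith
  exact lt_of_mul_lt_mul_left this h0.le

lemma dirichlet {l : ℕ} (x : Fin l → ℝ) (y : ℝ) (Q : ℕ) (δ η : ℝ) (hδ : 0 < δ) (hδ1 : δ ≤ 1)
    (hη : 0 < η) (hη1 : η ≤ 1) (h : 2 ^ (l + 1) ≤ Q * δ ^ l * η) :
    ∃ q : ℕ, 1 ≤ q ∧ q ≤ Q ∧ Nr x q δ ∧ ∃ p : ℤ, |(q : ℝ) * y - p| < η := by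
  have hceil : ∀ u : ℝ, 0 < u → u ≤ 1 → 0 < ⌈1 / u⌉₊ ∧ 1 ≤ ⌈1 / u⌉₊ * u ∧ ⌈1 / u⌉₊ * u ≤ 2 := by
    intro u hu hu1
    have h1 := Nat.le_ceil (1 / u)
    have h2 := Nat.ceil_lt_add_one (a := 1 / u) (by positivity)
    refine ⟨Nat.ceil_pos.2 (by positivity), by rwa [div_le_iff₀ hu] at h1, ?_⟩
    have : 1 / u * u = 1 := by field_simp
    nlinarith
  obtain ⟨ha0, ha1, ha2⟩ := hceil δ hδ hδ1
  obtain ⟨hb0, hb1, hb2⟩ := hceil η hη hη1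
  set a := ⌈1 / δ⌉₊
  set b := ⌈1 / η⌉₊
  let f : Fin (Q + 1) → (Fin l → Fin a) × Fin b := fun q =>
    (fun i => ⟨⌊a * Int.fract ((q : ℕ) * x i)⌋₊, cell_lt a ha0 _⟩,
      ⟨⌊b * Int.fract ((q : ℕ) * y)⌋₊, cell_lt b hb0 _⟩)
  have hcard : Fintype.card ((Fin l → Fin a) × Fin b) < Fintype.card (Fin (Q + 1)) := by
    simp only [Fintype.card_prod, Fintype.card_fun, Fintype.card_fin]
    refine Nat.lt_succ_of_le ?_
    have : ((a : ℝ) ^ l * b) ≤ Q := by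
      have h1 : ((a : ℝ) ^ l * b) * (δ ^ l * η) ≤ Q * (δ ^ l * η) := by
        calc ((a : ℝ) ^ l * b) * (δ ^ l * η) = (a * δ) ^ l * (b * η) := by rw [mul_pow]; ring
          _ ≤ 2 ^ l * 2 := by gcongr
          _ ≤ _ := by rw [← pow_succ]; linarith
      exact le_of_mul_le_mul_right h1 (by positivity)
    exact_mod_cast this
  obtain ⟨s, t, hst, hf⟩ := Fintype.exists_ne_map_eq_of_card_lt f hcard
  wlog hlt : (s : ℕ) < t generalizing s t
  · exact this t s hst.symm hf.symm (lt_of_le_of_ne (not_lt.1 hlt) fun h => hst (Fin.ext h.symm))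
  have hf1 := congrArg Prod.fst hf
  have hf2 := congrArg (fun z => (z.2 : ℕ)) hf
  refine ⟨t - s, by omega, by have := t.2; omega, fun i => ?_, ?_⟩
  · have := congrArg Fin.val (congrFun hf1 i)
    obtain ⟨p, hp⟩ := cell_eq a δ ha1 ha0 _ _ this
    refine ⟨p, ?_⟩
    rwa [Nat.cast_sub hlt.le, sub_mul]
  · obtain ⟨p, hp⟩ := cell_eq b η hb1 hb0 _ _ hf2
    refine ⟨p, ?_⟩
    rwa [Nat.cast_sub hlt.le, sub_mul]

lemma meas_q (q : ℕ) (hq : 1 ≤ q) (a L η : ℝ) (hL : 0 ≤ L) (hη : 0 < η) (hη1 : η ≤ 1) :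
    volume {y : ℝ | y ∈ Set.Icc a (a + L) ∧ ∃ p : ℤ, |(q : ℝ) * y - p| < η} ≤
      ENNReal.ofReal (2 * η * L + 6 * η / q) := by
  have hq0 : (0 : ℝ) < q := by exact_mod_cast hq
  set P := Finset.Ioc ⌊q * a - η⌋ ⌊q * (a + L) + η⌋ with hP
  have hsub : {y : ℝ | y ∈ Set.Icc a (a + L) ∧ ∃ p : ℤ, |(q : ℝ) * y - p| < η} ⊆
      ⋃ p ∈ P, Set.Ioo ((p - η) / q) ((p + η) / q) := by
    rintro y ⟨⟨h1, h2⟩, p, hp⟩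
    rw [abs_lt] at hp
    simp only [Set.mem_iUnion, Set.mem_Ioo]
    have b1 : q * a ≤ q * y := by gcongr
    have b2 : q * y ≤ q * (a + L) := by gcongr
    refine ⟨p, ?_, ?_, ?_⟩
    · rw [hP, Finset.mem_Ioc, Int.floor_lt, Int.le_floor]
      constructor <;> linarith [hp.1, hp.2]
    · rw [div_lt_iff₀ hq0]; linarith [hp.1, hp.2]
    · rw [lt_div_iff₀ hq0]; linarith [hp.1, hp.2]
  refine (measure_mono hsub).trans ((measure_biUnion_finset_le _ _).trans ?_)
  have e : ∀ p ∈ P, volume (Set.Ioo (((p : ℝ) - η) / q) ((p + η) / q)) = ENNReal.ofReal (2 * η / q) := by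
    intro p _
    rw [Real.volume_Ioo]; congr 1; ring
  rw [Finset.sum_congr rfl e, Finset.sum_const, nsmul_eq_mul, ← ENNReal.ofReal_natCast,
    ← ENNReal.ofReal_mul (by positivity)]
  apply ENNReal.ofReal_le_ofReal
  have hc : (P.card : ℝ) ≤ q * L + 3 := by
    rw [hP, Int.card_Ioc]
    have h1 := Int.lt_floor_add_one (q * a - η)
    have h2 := Int.floor_le (q * (a + L) + η)
    have h3 : ((⌊q * (a + L) + η⌋ - ⌊q * a - η⌋ : ℤ) : ℝ) ≤ q * L + 3 := by push_cast; linarith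
    have h4 : (0 : ℝ) ≤ q * L + 3 := by positivity
    rw [← Int.cast_natCast, Int.toNat_eq_max, Int.cast_max]
    exact max_le h3 (by simpa using h4)
  calc (P.card : ℝ) * (2 * η / q) ≤ (q * L + 3) * (2 * η / q) := by gcongr
    _ = _ := by field_simp; ring

lemma card_floor (u v : ℝ) (h : u ≤ v) : ((Finset.Icc ⌊u⌋ ⌊v⌋).card : ℝ) ≤ v - u + 2 := by
  rw [Int.card_Icc]
  have h1 := Int.lt_floor_add_one u
  have h2 := Int.floor_le v
  have h3 : ((⌊v⌋ + 1 - ⌊u⌋ : ℤ) : ℝ) ≤ v - u + 2 := by push_cast; linarith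
  rw [← Int.cast_natCast, Int.toNat_eq_max, Int.cast_max]
  exact max_le h3 (by simp; linarith)

/-- `z` is a rational point `p / q` with `q` in the block, and `q x` close to an integer vector. -/
def Gd {l : ℕ} (x : Fin l → ℝ) (κ n : ℕ) (δ z : ℝ) : Prop :=
  ∃ q : ℕ, 1 ≤ q ∧ 2 ^ n < q * 2 ^ κ ∧ q ≤ 2 ^ n ∧ Nr x q δ ∧ ∃ p : ℤ, z = p / q

lemma level {l : ℕ} (x : Fin l → ℝ) (κ n q0 : ℕ) (hκ : κ ≤ n) (a L δ C η ρ : ℝ) (hL : 0 < L)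
    (hδ : 0 < δ) (hδ1 : δ ≤ 1) (hη : η = 2 ^ (l + 1) / (2 ^ n * δ ^ l)) (hη1 : η ≤ 1)
    (hq0 : 6 ≤ L * q0) (hq0η : 6 * η * q0 ≤ L / 4) (hC : 12 * 2 ^ (l + 1) * C ≤ 2 ^ κ)
    (hN : (((Finset.Icc 1 (2 ^ (n - κ))).filter fun q => Nr x q δ).card : ℝ) ≤
      C * (2 ^ (n - κ) : ℕ) * δ ^ l)
    (hρ : ρ = 2 ^ κ * η / 2 ^ n) (hρL : 4 * ρ ≤ L) :
    ∃ (J : Finset ℤ) (z : ℤ → ℝ), (∀ j ∈ J, ⌊z j / ρ⌋ = j ∧ a - ρ ≤ z j ∧ z j ≤ a + L + ρ ∧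
      Gd x κ n δ (z j)) ∧ L / (6 * ρ) ≤ J.card ∧ J.card ≤ 2 * L / ρ := by
  have hη0 : 0 < η := by rw [hη]; positivity
  have hρ0 : 0 < ρ := by rw [hρ]; positivity
  set J : Finset ℤ := (Finset.Icc ⌊(a - ρ) / ρ⌋ ⌊(a + L + ρ) / ρ⌋).filter fun j =>
    ∃ z, ⌊z / ρ⌋ = j ∧ a - ρ ≤ z ∧ z ≤ a + L + ρ ∧ Gd x κ n δ z with hJ
  have hz : ∀ j : ℤ, ∃ z, j ∈ J → ⌊z / ρ⌋ = j ∧ a - ρ ≤ z ∧ z ≤ a + L + ρ ∧ Gd x κ n δ z := by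
    intro j
    by_cases h : j ∈ J
    · obtain ⟨z, hz⟩ := (Finset.mem_filter.1 h).2
      exact ⟨z, fun _ => hz⟩
    · exact ⟨0, fun h' => absurd h' h⟩
  choose z hz using hz
  refine ⟨J, z, hz, ?_, ?_⟩
  swap
  · have h1 : (J.card : ℝ) ≤ (Finset.Icc ⌊(a - ρ) / ρ⌋ ⌊(a + L + ρ) / ρ⌋).card := by
      exact_mod_cast Finset.card_filter_le _ _
    have h2 := card_floor ((a - ρ) / ρ) ((a + L + ρ) / ρ) (by gcongr; linarith)
    have h3 : (a + L + ρ) / ρ - (a - ρ) / ρ + 2 = L / ρ + 4 := by field_simp; ring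
    have h4 : 4 ≤ L / ρ := by rw [le_div_iff₀ hρ0]; exact hρL
    have h5 : 2 * L / ρ = L / ρ + L / ρ := by ring
    linarith
  set A := (Finset.Icc 1 (2 ^ (n - κ))).filter fun q => Nr x q δ with hA
  have hcov : Set.Icc a (a + L) ⊆
      (⋃ q ∈ A, {y : ℝ | y ∈ Set.Icc a (a + L) ∧ ∃ p : ℤ, |(q : ℝ) * y - p| < η}) ∪
      ⋃ j ∈ J, Set.Ioo ((j - 1) * ρ) ((j + 2) * ρ) := by
    intro y hy
    obtain ⟨q, hq1, hq2, hq3, p, hp⟩ := dirichlet x y (2 ^ n) δ η hδ hδ1 hη0 hη1 (by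
      rw [hη]; push_cast; apply le_of_eq; field_simp)
    have hqp : (0 : ℝ) < q := by exact_mod_cast hq1
    by_cases hqs : q * 2 ^ κ ≤ 2 ^ n
    · left
      simp only [Set.mem_iUnion]
      refine ⟨q, ?_, hy, p, hp⟩
      rw [hA, Finset.mem_filter, Finset.mem_Icc]
      refine ⟨⟨hq1, ?_⟩, hq3⟩
      rw [← Nat.sub_add_cancel hκ, pow_add] at hqs
      exact Nat.le_of_mul_le_mul_right hqs (by positivity)
    · right
      push Not at hqs
      have hd : |y - p / q| < ρ := by
        have e : y - p / q = (q * y - p) / q := by field_simp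
        rw [e, abs_div, abs_of_pos hqp, div_lt_iff₀ hqp, hρ]
        have : (2 : ℝ) ^ n ≤ q * 2 ^ κ := by exact_mod_cast hqs.le
        calc _ < η := hp
          _ = η * 2 ^ n / 2 ^ n := by field_simp
          _ ≤ η * (q * 2 ^ κ) / 2 ^ n := by gcongr
          _ = _ := by ring
      rw [abs_lt] at hd
      have hg : a - ρ ≤ p / q ∧ (p : ℝ) / q ≤ a + L + ρ := by
        constructor <;> linarith [hy.1, hy.2, hd.1, hd.2]
      simp only [Set.mem_iUnion]
      refine ⟨⌊(p / q : ℝ) / ρ⌋, ?_, ?_⟩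
      · rw [hJ, Finset.mem_filter, Finset.mem_Icc]
        refine ⟨⟨Int.floor_le_floor ?_, Int.floor_le_floor ?_⟩, _, rfl, hg.1, hg.2,
          q, hq1, hqs, hq2, hq3, p, rfl⟩
        · gcongr; exact hg.1
        · gcongr; exact hg.2
      · have h1 := Int.floor_le ((p / q : ℝ) / ρ)
        have h2 := Int.lt_floor_add_one ((p / q : ℝ) / ρ)
        rw [le_div_iff₀ hρ0] at h1
        rw [div_lt_iff₀ hρ0] at h2
        constructor <;> nlinarith [hd.1, hd.2]
  have hm := measure_mono (μ := volume) hcov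
  have hb1 : volume (⋃ q ∈ A, {y : ℝ | y ∈ Set.Icc a (a + L) ∧ ∃ p : ℤ, |(q : ℝ) * y - p| < η}) ≤
      ENNReal.ofReal (L / 2) := by
    refine (measure_biUnion_finset_le _ _).trans ?_
    have h1 : ∀ q ∈ A, volume {y : ℝ | y ∈ Set.Icc a (a + L) ∧ ∃ p : ℤ, |(q : ℝ) * y - p| < η} ≤
        ENNReal.ofReal (3 * η * L + if q < q0 then 6 * η else 0) := by
      intro q hq
      rw [hA, Finset.mem_filter, Finset.mem_Icc] at hq
      refine (meas_q q hq.1.1 a L η hL.le hη0 hη1).trans (ENNReal.ofReal_le_ofReal ?_)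
      have hq1 : (1 : ℝ) ≤ q := by exact_mod_cast hq.1.1
      have hLη : 0 < η * L := by positivity
      split_ifs with h
      · have : 6 * η / q ≤ 6 * η := div_le_self (by positivity) hq1
        linarith
      · have hq' : (q0 : ℝ) ≤ q := by exact_mod_cast not_lt.1 h
        have : 6 * η / q ≤ η * L := by
          rw [div_le_iff₀ (by linarith)]
          have : L * q0 ≤ L * q := by gcongr
          nlinarith
        linarith
    refine (Finset.sum_le_sum h1).trans ?_
    rw [← ENNReal.ofReal_sum_of_nonneg (fun q _ => by split_ifs <;> positivity)]
    apply ENNReal.ofReal_le_ofReal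
    rw [Finset.sum_add_distrib, Finset.sum_const, nsmul_eq_mul, ← Finset.sum_filter,
      Finset.sum_const, nsmul_eq_mul]
    have h2 : ((A.filter fun q => q < q0).card : ℝ) ≤ q0 := by
      have : (A.filter fun q => q < q0).card ≤ (Finset.range q0).card :=
        Finset.card_le_card fun q hq => Finset.mem_range.2 (Finset.mem_filter.1 hq).2
      rw [Finset.card_range] at this
      exact_mod_cast this
    have h3 : (A.card : ℝ) * (3 * η * L) ≤ L / 4 := by
      have e : ((2 ^ (n - κ) : ℕ) : ℝ) = 2 ^ n / 2 ^ κ := by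
        push_cast
        rw [eq_div_iff (by positivity), ← pow_add, Nat.sub_add_cancel hκ]
      rw [e] at hN
      calc (A.card : ℝ) * (3 * η * L) ≤ (C * (2 ^ n / 2 ^ κ) * δ ^ l) * (3 * η * L) := by gcongr
        _ = (12 * 2 ^ (l + 1) * C) * (L / 4 / 2 ^ κ) := by rw [hη]; field_simp; ring
        _ ≤ 2 ^ κ * (L / 4 / 2 ^ κ) := by gcongr
        _ = L / 4 := by field_simp
    have h4 : ((A.filter fun q => q < q0).card : ℝ) * (6 * η) ≤ q0 * (6 * η) := by gcongr
    linarith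
  have hb2 : volume (⋃ j ∈ J, Set.Ioo (((j : ℝ) - 1) * ρ) ((j + 2) * ρ)) ≤
      ENNReal.ofReal (J.card * (3 * ρ)) := by
    refine (measure_biUnion_finset_le _ _).trans ?_
    have h1 : ∀ j ∈ J, volume (Set.Ioo (((j : ℝ) - 1) * ρ) ((j + 2) * ρ)) = ENNReal.ofReal (3 * ρ) := by
      intro j _
      rw [Real.volume_Ioo]; congr 1; ring
    rw [Finset.sum_congr rfl h1, Finset.sum_const, nsmul_eq_mul, ← ENNReal.ofReal_natCast,
      ← ENNReal.ofReal_mul (by positivity)]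
  have hf := hm.trans ((measure_union_le _ _).trans (add_le_add hb1 hb2))
  rw [Real.volume_Icc, ← ENNReal.ofReal_add (by positivity) (by positivity),
    ENNReal.ofReal_le_ofReal_iff (by positivity)] at hf
  rw [div_le_iff₀ (by positivity)]
  linarith

lemma second_moment {ι : Type*} (s : Finset ι) (B : ι → Set ℝ) (V : Set ℝ)
    (hB : ∀ i ∈ s, MeasurableSet (B i)) (hV : MeasurableSet V) (hVf : volume V ≠ ∞)
    (hsub : ∀ i ∈ s, B i ⊆ V) (t : ℝ) :
    2 * t * ∑ i ∈ s, volume.real (B i) ≤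
      ∑ i ∈ s, ∑ j ∈ s, volume.real (B i ∩ B j) + t ^ 2 * volume.real V := by
  have hBf : ∀ i ∈ s, volume (B i) ≠ ∞ := fun i hi => measure_ne_top_of_subset (hsub i hi) hVf
  let I : Set ℝ → ℝ → ℝ := fun A => A.indicator 1
  have hI : ∀ A : Set ℝ, MeasurableSet A → volume A ≠ ∞ → Integrable (I A) := fun A hA hAf =>
    (integrable_indicator_iff hA).2 (integrableOn_const hAf)
  have hIi : ∀ A : Set ℝ, MeasurableSet A → ∫ y, I A y = volume.real A := fun A hA =>
    integral_indicator_one hA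
  have hpt : ∀ y, 0 ≤ (∑ i ∈ s, ∑ j ∈ s, I (B i ∩ B j) y) - 2 * t * (∑ i ∈ s, I (B i) y) +
      t ^ 2 * I V y := by
    intro y
    have e1 : ∑ i ∈ s, ∑ j ∈ s, I (B i ∩ B j) y = (∑ i ∈ s, I (B i) y) ^ 2 := by
      rw [sq, Finset.sum_mul_sum]
      refine Finset.sum_congr rfl fun i _ => Finset.sum_congr rfl fun j _ => ?_
      simp only [I, Set.inter_indicator_one, Pi.mul_apply]
    rw [e1]
    by_cases hy : y ∈ V
    · have : I V y = 1 := by simp [I, hy]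
      rw [this]
      nlinarith [sq_nonneg ((∑ i ∈ s, I (B i) y) - t)]
    · have : I V y = 0 := by simp [I, hy]
      have h0 : ∑ i ∈ s, I (B i) y = 0 := Finset.sum_eq_zero fun i hi => by
        have : y ∉ B i := fun h => hy (hsub i hi h)
        simp [I, this]
      rw [this, h0]; simp
  have hint := integral_nonneg (μ := volume) (f := fun y => (∑ i ∈ s, ∑ j ∈ s, I (B i ∩ B j) y) -
    2 * t * (∑ i ∈ s, I (B i) y) + t ^ 2 * I V y) hpt
  have i1 : ∀ i ∈ s, ∀ j ∈ s, Integrable (fun y => I (B i ∩ B j) y) := fun i hi j hj =>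
    hI _ ((hB i hi).inter (hB j hj)) (measure_ne_top_of_subset Set.inter_subset_left (hBf i hi))
  have i2 : ∀ i ∈ s, Integrable (fun y => I (B i) y) := fun i hi => hI _ (hB i hi) (hBf i hi)
  have j1 : Integrable (fun y => ∑ i ∈ s, ∑ j ∈ s, I (B i ∩ B j) y) :=
    integrable_finsetSum _ fun i hi => integrable_finsetSum _ fun j hj => i1 i hi j hj
  have j2 : Integrable (fun y => 2 * t * ∑ i ∈ s, I (B i) y) :=
    (integrable_finsetSum _ i2).const_mul _
  have j3 : Integrable (fun y => (∑ i ∈ s, ∑ j ∈ s, I (B i ∩ B j) y) -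
    2 * t * ∑ i ∈ s, I (B i) y) := j1.sub j2
  rw [integral_add j3 ((hI V hV hVf).const_mul _), integral_sub j1 j2,
    integral_const_mul, integral_const_mul, hIi V hV, integral_finsetSum _ i2,
    integral_finsetSum _ fun i hi => integrable_finsetSum _ fun j hj => i1 i hi j hj] at hint
  have k1 : ∑ i ∈ s, ∫ y, I (B i) y = ∑ i ∈ s, volume.real (B i) :=
    Finset.sum_congr rfl fun i hi => hIi _ (hB i hi)
  have k2 : ∑ i ∈ s, ∫ y, ∑ j ∈ s, I (B i ∩ B j) y = ∑ i ∈ s, ∑ j ∈ s, volume.real (B i ∩ B j) :=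
    Finset.sum_congr rfl fun i hi => by
      rw [integral_finsetSum _ fun j hj => i1 i hi j hj]
      exact Finset.sum_congr rfl fun j hj => hIi _ ((hB i hi).inter (hB j hj))
  rw [k1, k2] at hint
  linarith

lemma pair_bound (J : Finset ℤ) (z : ℤ → ℝ) (w ρ Ψ Ψ' : ℝ) (hρ : 0 < ρ) (hΨ : 0 < Ψ) (hΨ' : Ψ ≤ Ψ')
    (hz : ∀ j ∈ J, ⌊z j / ρ⌋ = j) :
    ∑ j ∈ J, volume.real (Set.Ioo (w - Ψ') (w + Ψ') ∩ Set.Ioo (z j - Ψ) (z j + Ψ)) ≤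
      (4 * Ψ' / ρ + 2) * (2 * Ψ) := by
  set I := Finset.Icc ⌊(w - 2 * Ψ') / ρ⌋ ⌊(w + 2 * Ψ') / ρ⌋ with hI
  have h1 : ∀ j ∈ J, volume.real (Set.Ioo (w - Ψ') (w + Ψ') ∩ Set.Ioo (z j - Ψ) (z j + Ψ)) ≤
      if j ∈ I then 2 * Ψ else 0 := by
    intro j hj
    split_ifs with h
    · refine (measureReal_mono Set.inter_subset_right (by simp)).trans (le_of_eq ?_)
      rw [Real.volume_real_Ioo_of_le (by linarith)]; ring
    · have : Set.Ioo (w - Ψ') (w + Ψ') ∩ Set.Ioo (z j - Ψ) (z j + Ψ) = ∅ := by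
        by_contra hne
        obtain ⟨y, ⟨a1, a2⟩, a3, a4⟩ := Set.nonempty_iff_ne_empty.2 hne
        apply h
        rw [hI, Finset.mem_Icc, ← hz j hj]
        constructor <;> apply Int.floor_le_floor <;> gcongr <;> linarith
      rw [this]; simp
  refine (Finset.sum_le_sum h1).trans ?_
  rw [← Finset.sum_filter, Finset.sum_const, nsmul_eq_mul]
  have h2 : ((J.filter fun j => j ∈ I).card : ℝ) ≤ I.card := by
    exact_mod_cast Finset.card_le_card fun j hj => (Finset.mem_filter.1 hj).2
  have h3 := card_floor ((w - 2 * Ψ') / ρ) ((w + 2 * Ψ') / ρ) (by gcongr; linarith)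
  have h4 : (w + 2 * Ψ') / ρ - (w - 2 * Ψ') / ρ = 4 * Ψ' / ρ := by ring
  have h5 : ((J.filter fun j => j ∈ I).card : ℝ) ≤ 4 * Ψ' / ρ + 2 := by rw [← h4]; linarith
  gcongr

lemma kgeom_le (M N m : ℕ) : ∑ n ∈ Finset.Ico M N, (if m ≤ n then (1 / 2 : ℝ) ^ (n - m) else 0) ≤ 2 := by
  rw [← Finset.sum_filter]
  have h1 : ∑ n ∈ (Finset.Ico M N).filter (fun n => m ≤ n), (1 / 2 : ℝ) ^ (n - m) ≤
      ∑ n ∈ Finset.Ico m (m + N), (1 / 2 : ℝ) ^ (n - m) := by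
    apply Finset.sum_le_sum_of_subset_of_nonneg
    · intro n hn
      rw [Finset.mem_filter, Finset.mem_Ico] at hn
      rw [Finset.mem_Ico]; omega
    · intros; positivity
  refine h1.trans ?_
  rw [Finset.sum_Ico_eq_sum_range]
  simp only [add_tsub_cancel_left]
  exact sum_geometric_two_le _

lemma union_measure (L : ℝ) (hL : 0 < L) (M N : ℕ) (α ρ Ψ : ℕ → ℝ) (J : ℕ → Finset ℤ)
    (z : ℕ → ℤ → ℝ) (V : Set ℝ) (hV : MeasurableSet V) (hVf : volume V ≠ ∞)
    (hρ : ∀ n, 0 < ρ n) (hΨ : ∀ n, 0 < Ψ n) (hα : ∀ n, Ψ n / ρ n = α n)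
    (hanti : ∀ m n, m ≤ n → Ψ n ≤ Ψ m)
    (hdec : ∀ m n, m ≤ n → Ψ n / ρ m ≤ (1 / 2) ^ (n - m) * α m)
    (hz : ∀ n, M ≤ n → ∀ j ∈ J n, ⌊z n j / ρ n⌋ = j)
    (hJ1 : ∀ n, M ≤ n → L / (6 * ρ n) ≤ (J n).card)
    (hJ2 : ∀ n, M ≤ n → ((J n).card : ℝ) ≤ 2 * L / ρ n)
    (hsub : ∀ n, M ≤ n → ∀ j ∈ J n, Set.Ioo (z n j - Ψ n) (z n j + Ψ n) ⊆ V)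
    (hA : 1 ≤ ∑ n ∈ Finset.Ico M N, α n) : L / 576 ≤ volume.real V := by
  set A := ∑ n ∈ Finset.Ico M N, α n with hAdef
  let B : (Σ _ : ℕ, ℤ) → Set ℝ := fun i => Set.Ioo (z i.1 i.2 - Ψ i.1) (z i.1 i.2 + Ψ i.1)
  have hα0 : ∀ n, 0 < α n := fun n => by rw [← hα]; exact div_pos (hΨ n) (hρ n)
  have key := second_moment ((Finset.Ico M N).sigma J) B V (fun _ _ => measurableSet_Ioo) hV hVf
    (fun i hi => by
      rw [Finset.mem_sigma, Finset.mem_Ico] at hi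
      exact hsub _ hi.1.1 _ hi.2) (192 * A)
  have hS : L * A / 3 ≤ ∑ i ∈ (Finset.Ico M N).sigma J, volume.real (B i) := by
    rw [Finset.sum_sigma, hAdef, Finset.mul_sum, Finset.sum_div]
    apply Finset.sum_le_sum
    intro n hn
    rw [Finset.mem_Ico] at hn
    have e : ∀ j ∈ J n, volume.real (B ⟨n, j⟩) = 2 * Ψ n := by
      intro j _
      simp only [B]
      rw [Real.volume_real_Ioo_of_le (by linarith [hΨ n])]; ring
    rw [Finset.sum_congr rfl e, Finset.sum_const, nsmul_eq_mul]
    have h1 : L / (6 * ρ n) * (2 * Ψ n) ≤ (J n).card * (2 * Ψ n) := by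
      have := hΨ n
      have := hJ1 n hn.1
      gcongr
    refine le_trans (le_of_eq ?_) h1
    rw [← hα]
    have := (hρ n).ne'
    field_simp
    ring
  let W : ℕ → ℕ → ℝ := fun m n => ∑ j ∈ J m, ∑ k ∈ J n, volume.real (B ⟨m, j⟩ ∩ B ⟨n, k⟩)
  have hWs : ∀ m n, W m n = W n m := by
    intro m n
    simp only [W]
    rw [Finset.sum_comm]
    simp_rw [Set.inter_comm]
  have hW1 : ∀ m n, M ≤ m → m ≤ n → W m n ≤ 16 * L * (α m * α n) + 8 * L * ((1 / 2) ^ (n - m) * α m) := by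
    intro m n hm hmn
    have h1 : W m n ≤ ∑ j ∈ J m, (4 * Ψ m / ρ n + 2) * (2 * Ψ n) :=
      Finset.sum_le_sum fun j _ => pair_bound (J n) (z n) (z m j) (ρ n) (Ψ n) (Ψ m) (hρ n) (hΨ n)
        (hanti m n hmn) (hz n (hm.trans hmn))
    rw [Finset.sum_const, nsmul_eq_mul] at h1
    have := hΨ n
    have := hΨ m
    have hρn := hρ n
    have hρm := hρ m
    have h2 : (J m).card * ((4 * Ψ m / ρ n + 2) * (2 * Ψ n)) ≤
        2 * L / ρ m * ((4 * Ψ m / ρ n + 2) * (2 * Ψ n)) := by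
      have := hJ2 m hm
      gcongr
    have h3 : 2 * L / ρ m * ((4 * Ψ m / ρ n + 2) * (2 * Ψ n)) =
        16 * L * (Ψ m / ρ m * (Ψ n / ρ n)) + 8 * L * (Ψ n / ρ m) := by
      field_simp; ring
    rw [h3, hα, hα] at h2
    have h4 : 8 * L * (Ψ n / ρ m) ≤ 8 * L * ((1 / 2) ^ (n - m) * α m) := by
      have := hdec m n hmn
      gcongr
    linarith
  let g : ℕ → ℕ → ℝ := fun m n => if m ≤ n then (1 / 2 : ℝ) ^ (n - m) else 0
  have hg : ∀ m n, 0 ≤ g m n := fun m n => by simp only [g]; split_ifs <;> positivity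
  have hW2 : ∀ m ∈ Finset.Ico M N, ∀ n ∈ Finset.Ico M N,
      W m n ≤ 16 * L * (α m * α n) + 8 * L * (g m n * α m + g n m * α n) := by
    intro m hm n hn
    rw [Finset.mem_Ico] at hm hn
    have q1 := mul_nonneg (hg m n) (hα0 m).le
    have q2 := mul_nonneg (hg n m) (hα0 n).le
    rcases le_total m n with h | h
    · have e : g m n = (1 / 2) ^ (n - m) := if_pos h
      have := hW1 m n hm.1 h
      rw [← e] at this
      nlinarith
    · have e : g n m = (1 / 2) ^ (m - n) := if_pos h
      have := hW1 n m hn.1 h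
      rw [← e, hWs] at this
      nlinarith
  have hT : ∑ i ∈ (Finset.Ico M N).sigma J, ∑ j ∈ (Finset.Ico M N).sigma J, volume.real (B i ∩ B j) ≤
      16 * L * A ^ 2 + 32 * L * A := by
    have e : ∑ i ∈ (Finset.Ico M N).sigma J, ∑ j ∈ (Finset.Ico M N).sigma J, volume.real (B i ∩ B j) =
        ∑ m ∈ Finset.Ico M N, ∑ n ∈ Finset.Ico M N, W m n := by
      simp only [Finset.sum_sigma, W]
      refine Finset.sum_congr rfl fun m _ => ?_
      rw [Finset.sum_comm]
    rw [e]
    refine (Finset.sum_le_sum fun m hm => Finset.sum_le_sum fun n hn => hW2 m hm n hn).trans ?_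
    have e1 : ∑ m ∈ Finset.Ico M N, ∑ n ∈ Finset.Ico M N, g m n * α m ≤ 2 * A := by
      rw [hAdef, Finset.mul_sum]
      apply Finset.sum_le_sum
      intro m _
      rw [← Finset.sum_mul]
      have := kgeom_le M N m
      have := hα0 m
      gcongr
    have e2 : ∑ m ∈ Finset.Ico M N, ∑ n ∈ Finset.Ico M N, g n m * α n ≤ 2 * A := by
      rw [Finset.sum_comm]; exact e1
    have e3 : ∑ m ∈ Finset.Ico M N, ∑ n ∈ Finset.Ico M N, α m * α n = A ^ 2 := by
      rw [sq, hAdef, Finset.sum_mul_sum]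
    simp only [Finset.sum_add_distrib, ← Finset.mul_sum]
    simp only [← Finset.mul_sum] at e3
    rw [e3]
    nlinarith
  have hA2 : A ≤ A ^ 2 := by nlinarith
  have h1 : 2 * (192 * A) * (L * A / 3) ≤ 2 * (192 * A) *
      ∑ i ∈ (Finset.Ico M N).sigma J, volume.real (B i) := by gcongr
  have h2 : L * A ≤ L * A ^ 2 := by gcongr
  have h3 : 80 * L * A ^ 2 ≤ (192 * A) ^ 2 * volume.real V := by nlinarith
  have hA2p : 0 < A ^ 2 := by positivity
  have h4 : A ^ 2 * (64 * L) ≤ A ^ 2 * (36864 * volume.real V) := by nlinarith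
  have h5 := le_of_mul_le_mul_left h4 hA2p
  linarith

lemma full_of_density (U : Set ℝ) (hU : MeasurableSet U) (c : ℝ) (hc : 0 < c)
    (h : ∀ a L : ℝ, 0 < L → ENNReal.ofReal (c * L) ≤ volume (U ∩ Set.Icc (a - L) (a + 2 * L))) :
    ∀ᵐ y : ℝ, y ∈ U := by
  filter_upwards [Besicovitch.ae_tendsto_measure_inter_div_of_measurableSet volume hU] with y hy
  by_contra hyU
  rw [Set.indicator_of_notMem hyU] at hy
  have h1 : ∀ᶠ r : ℝ in nhdsWithin 0 (Set.Ioi 0), ENNReal.ofReal (c / 3) ≤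
      volume (U ∩ Metric.closedBall y r) / volume (Metric.closedBall y r) := by
    filter_upwards [self_mem_nhdsWithin] with r hr
    have hr' : (0 : ℝ) < r := hr
    have h2 := h (y - r / 3) (2 * r / 3) (by positivity)
    have e1 : y - r / 3 - 2 * r / 3 = y - r := by ring
    have e2 : y - r / 3 + 2 * (2 * r / 3) = y + r := by ring
    rw [e1, e2, ← Real.closedBall_eq_Icc] at h2
    rw [Real.volume_closedBall, ENNReal.le_div_iff_mul_le (by left; simpa using hr') (by left; exact ENNReal.ofReal_ne_top),
      ← ENNReal.ofReal_mul (by positivity)]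
    refine le_trans (le_of_eq ?_) h2
    congr 1; ring
  have h3 := ge_of_tendsto hy h1
  simp at h3
  linarith

lemma divergence {l : ℕ} (x : Fin l → ℝ) (κ : ℕ) (C : ℝ) (hC : 12 * 2 ^ (l + 1) * C ≤ 2 ^ κ)
    (δ : ℕ → ℝ) (hδ : ∀ n, 0 < δ n) (hδ1 : ∀ n, δ n ≤ 1) (hanti : Antitone δ)
    (hN : ∀ᶠ n : ℕ in atTop, (((Finset.Icc 1 (2 ^ (n - κ))).filter fun q => Nr x q (δ n)).card : ℝ) ≤
      C * (2 ^ (n - κ) : ℕ) * (δ n) ^ l)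
    (hη : Tendsto (fun n => 2 ^ (l + 1) / ((2 : ℝ) ^ n * δ n ^ l)) atTop (nhds 0))
    (hdiv : ¬ Summable fun n => (2 : ℝ) ^ n * δ n ^ (l + 1)) (N0 : ℕ) :
    ∀ᵐ y : ℝ, ∃ n, N0 ≤ n ∧ ∃ q : ℕ, 1 ≤ q ∧ 2 ^ n < q * 2 ^ κ ∧ q ≤ 2 ^ n ∧ Nr x q (δ n) ∧
      ∃ p : ℤ, |(q : ℝ) * y - p| < δ n := by
  set η : ℕ → ℝ := fun n => 2 ^ (l + 1) / ((2 : ℝ) ^ n * δ n ^ l) with hηdef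
  set ρ : ℕ → ℝ := fun n => 2 ^ κ * η n / 2 ^ n with hρdef
  set Ψ : ℕ → ℝ := fun n => δ n / 2 ^ n with hΨdef
  have hη0 : ∀ n, 0 < η n := fun n => by have := hδ n; simp only [hηdef]; positivity
  have hρ0 : ∀ n, 0 < ρ n := fun n => by have := hη0 n; simp only [hρdef]; positivity
  have hΨ0 : ∀ n, 0 < Ψ n := fun n => by have := hδ n; simp only [hΨdef]; positivity
  have hρt : Tendsto ρ atTop (nhds 0) := by
    have h1 : Tendsto (fun n => 2 ^ κ * η n) atTop (nhds 0) := by simpa using hη.const_mul (2 ^ κ)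
    refine squeeze_zero (fun n => (hρ0 n).le) (fun n => ?_) h1
    exact div_le_self (by have := hη0 n; positivity) (one_le_pow₀ (by norm_num))
  have hΨt : Tendsto Ψ atTop (nhds 0) := by
    have h1 : Tendsto (fun n : ℕ => (1 / 2 : ℝ) ^ n) atTop (nhds 0) :=
      tendsto_pow_atTop_nhds_zero_of_lt_one (by norm_num) (by norm_num)
    refine squeeze_zero (fun n => (hΨ0 n).le) (fun n => ?_) h1
    simp only [hΨdef]
    rw [one_div_pow]
    gcongr
    exact hδ1 n
  let U : Set ℝ := ⋃ n ∈ {n | N0 ≤ n}, ⋃ z ∈ {z | Gd x κ n (δ n) z}, Set.Ioo (z - Ψ n) (z + Ψ n)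
  have hUo : IsOpen U := isOpen_biUnion fun n _ => isOpen_biUnion fun z _ => isOpen_Ioo
  have hUf : ∀ᵐ y : ℝ, y ∈ U := by
    refine full_of_density U hUo.measurableSet (1 / 576) (by norm_num) fun a L hL => ?_
    obtain ⟨q0, hq0⟩ := exists_nat_ge (6 / L)
    rw [div_le_iff₀ hL] at hq0
    have ev1 : ∀ᶠ n in atTop, η n ≤ 1 := hη.eventually_le_const (by norm_num)
    have ev2 : ∀ᶠ n in atTop, 6 * η n * q0 ≤ L / 4 := by
      have : Tendsto (fun n => 6 * η n * q0) atTop (nhds 0) := by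
        simpa using (hη.const_mul 6).mul_const (q0 : ℝ)
      exact this.eventually_le_const (by positivity)
    have ev3 : ∀ᶠ n in atTop, 4 * ρ n ≤ L := by
      have : Tendsto (fun n => 4 * ρ n) atTop (nhds 0) := by simpa using hρt.const_mul 4
      exact this.eventually_le_const hL
    have ev4 : ∀ᶠ n in atTop, Ψ n ≤ L / 2 := hΨt.eventually_le_const (by positivity)
    obtain ⟨M, hM⟩ := eventually_atTop.1 (ev1.and (ev2.and (ev3.and (ev4.and (hN.and
      ((eventually_ge_atTop κ).and (eventually_ge_atTop N0)))))))
    have hex : ∀ n, ∃ (J : Finset ℤ) (z : ℤ → ℝ), M ≤ n →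
        (∀ j ∈ J, ⌊z j / ρ n⌋ = j ∧ a - ρ n ≤ z j ∧ z j ≤ a + L + ρ n ∧
        Gd x κ n (δ n) (z j)) ∧ L / (6 * ρ n) ≤ J.card ∧ J.card ≤ 2 * L / ρ n := by
      intro n
      by_cases hn : M ≤ n
      · obtain ⟨h1, h2, h3, h4, h5, h6, h7⟩ := hM n hn
        obtain ⟨J, z, h⟩ := level x κ n q0 h6 a L (δ n) C (η n) (ρ n) hL (hδ n) (hδ1 n) rfl h1
          (by linarith) h2 hC h5 rfl h3
        exact ⟨J, z, fun _ => h⟩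
      · exact ⟨∅, 0, fun h => absurd h hn⟩
    choose J z hJz using hex
    set V := U ∩ Set.Icc (a - L) (a + 2 * L) with hV
    have hVf : volume V ≠ ∞ := measure_ne_top_of_subset Set.inter_subset_right (by simp)
    set α : ℕ → ℝ := fun n => Ψ n / ρ n with hα
    have hαe : ∀ n, α n = (2 ^ n * δ n ^ (l + 1)) / (2 ^ κ * 2 ^ (l + 1)) := by
      intro n
      have := hδ n
      simp only [hα, hΨdef, hρdef, hηdef]
      field_simp
      ring
    have hαns : ¬ Summable α := by
      intro h
      apply hdiv
      have h2 := h.mul_left (2 ^ κ * 2 ^ (l + 1))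
      refine h2.congr fun n => ?_
      rw [hαe]; field_simp
    have hα0 : ∀ n, 0 ≤ α n := fun n => (div_pos (hΨ0 n) (hρ0 n)).le
    have hA : ∃ N, M ≤ N ∧ 1 ≤ ∑ n ∈ Finset.Ico M N, α n := by
      have ht := (not_summable_iff_tendsto_nat_atTop_of_nonneg hα0).1 hαns
      obtain ⟨N, hN1, hN2⟩ := ((ht.eventually_ge_atTop (1 + ∑ n ∈ Finset.range M, α n)).and
        (eventually_ge_atTop M)).exists
      refine ⟨N, hN2, ?_⟩
      rw [Finset.sum_Ico_eq_sub _ hN2]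
      linarith
    obtain ⟨N, -, hA⟩ := hA
    have := union_measure L hL M N α ρ Ψ J z V (hUo.measurableSet.inter measurableSet_Icc) hVf
      hρ0 hΨ0 (fun _ => rfl)
      (fun m n hmn => by
        have := hanti hmn
        have := hδ m
        have : (2 : ℝ) ^ m ≤ 2 ^ n := pow_le_pow_right₀ (by norm_num) hmn
        simp only [hΨdef]
        gcongr)
      (fun m n hmn => by
        have h1 := hanti hmn
        have := hδ m
        have := hρ0 m
        simp only [hα, hΨdef]
        have e : (1 / 2 : ℝ) ^ (n - m) * (δ m / 2 ^ m / ρ m) = δ m / 2 ^ n / ρ m := by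
          have : (2 : ℝ) ^ n = 2 ^ (n - m) * 2 ^ m := by rw [← pow_add, Nat.sub_add_cancel hmn]
          rw [this, one_div_pow]
          field_simp
        rw [e]
        gcongr)
      (fun n hn j hj => ((hJz n hn).1 j hj).1) (fun n hn => (hJz n hn).2.1)
      (fun n hn => (hJz n hn).2.2)
      (fun n hn j hj y hy => by
        obtain ⟨-, b1, b2, b3⟩ := (hJz n hn).1 j hj
        obtain ⟨h1, h2, h3, h4, h5, h6, h7⟩ := hM n hn
        refine ⟨?_, ?_, ?_⟩
        · simp only [U, Set.mem_iUnion]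
          exact ⟨n, h7, z n j, b3, hy⟩
        · linarith [hy.1]
        · linarith [hy.2]) hA
    rw [← ofReal_measureReal hVf]
    apply ENNReal.ofReal_le_ofReal
    linarith
  filter_upwards [hUf] with y hy
  simp only [U, Set.mem_iUnion] at hy
  obtain ⟨n, hn, z, ⟨q, hq1, hq2, hq3, hq4, p, rfl⟩, hy⟩ := hy
  refine ⟨n, hn, q, hq1, hq2, hq3, hq4, p, ?_⟩
  have hqp : (0 : ℝ) < q := by exact_mod_cast hq1
  have hlt : |y - p / q| < Ψ n := by
    rw [abs_lt]; constructor <;> linarith [hy.1, hy.2]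
  have e : (q : ℝ) * y - p = q * (y - p / q) := by field_simp
  rw [e, abs_mul, abs_of_pos hqp]
  have h2 : (q : ℝ) ≤ 2 ^ n := by exact_mod_cast hq3
  calc (q : ℝ) * |y - p / q| < q * Ψ n := by gcongr
    _ ≤ 2 ^ n * Ψ n := by have := hΨ0 n; gcongr
    _ = δ n := by simp only [hΨdef]; field_simp

lemma convergence {l : ℕ} (x : Fin l → ℝ) (C : ℝ) (φ : ℕ → ℝ) (hφ : ∀ n, 0 < φ n)
    (hφ1 : ∀ n, φ n ≤ 1)
    (hN : ∀ᶠ n : ℕ in atTop, (((Finset.Icc 1 (2 ^ n)).filter fun q => Nr x q (φ n)).card : ℝ) ≤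
      C * (2 ^ n : ℕ) * (φ n) ^ l)
    (hs : Summable fun n => (2 : ℝ) ^ n * φ n ^ (l + 1)) :
    ∀ᵐ y : ℝ, ∀ᶠ n in atTop, ¬ ∃ q : ℕ, 1 ≤ q ∧ q ≤ 2 ^ n ∧ Nr x q (φ n) ∧
      ∃ p : ℤ, |(q : ℝ) * y - p| < φ n := by
  obtain ⟨M, hM⟩ := eventually_atTop.1 hN
  have key : ∀ R : ℕ, ∀ᵐ y : ℝ, ∀ᶠ n in atTop, y ∉ {y : ℝ | y ∈ Set.Icc (-(R : ℝ)) R ∧ ∃ q : ℕ,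
      1 ≤ q ∧ q ≤ 2 ^ (n + M) ∧ Nr x q (φ (n + M)) ∧ ∃ p : ℤ, |(q : ℝ) * y - p| < φ (n + M)} := by
    intro R
    apply ae_eventually_notMem
    have hs2 : Summable fun n => (C * (4 * R + 6)) * ((2 : ℝ) ^ (n + M) * φ (n + M) ^ (l + 1)) :=
      ((summable_nat_add_iff M).2 hs).mul_left _
    refine ne_top_of_le_ne_top hs2.tsum_ofReal_ne_top (ENNReal.tsum_le_tsum fun n => ?_)
    set A := (Finset.Icc 1 (2 ^ (n + M))).filter fun q => Nr x q (φ (n + M)) with hA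
    have hsub : {y : ℝ | y ∈ Set.Icc (-(R : ℝ)) R ∧ ∃ q : ℕ,
      1 ≤ q ∧ q ≤ 2 ^ (n + M) ∧ Nr x q (φ (n + M)) ∧ ∃ p : ℤ, |(q : ℝ) * y - p| < φ (n + M)} ⊆
      ⋃ q ∈ A, {y : ℝ | y ∈ Set.Icc (-(R : ℝ)) (-(R : ℝ) + 2 * R) ∧
        ∃ p : ℤ, |(q : ℝ) * y - p| < φ (n + M)} := by
      rintro y ⟨hy, q, h1, h2, h3, h4⟩
      simp only [Set.mem_iUnion]
      refine ⟨q, ?_, ⟨hy.1, by linarith [hy.2]⟩, h4⟩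
      rw [hA, Finset.mem_filter, Finset.mem_Icc]
      exact ⟨⟨h1, h2⟩, h3⟩
    refine (measure_mono hsub).trans ((measure_biUnion_finset_le _ _).trans ?_)
    have hp := hφ (n + M)
    have h1 : ∀ q ∈ A, volume {y : ℝ | y ∈ Set.Icc (-(R : ℝ)) (-(R : ℝ) + 2 * R) ∧
        ∃ p : ℤ, |(q : ℝ) * y - p| < φ (n + M)} ≤ ENNReal.ofReal (φ (n + M) * (4 * R + 6)) := by
      intro q hq
      rw [hA, Finset.mem_filter, Finset.mem_Icc] at hq
      refine (meas_q q hq.1.1 _ _ _ (by positivity) hp (hφ1 _)).trans (ENNReal.ofReal_le_ofReal ?_)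
      have : 6 * φ (n + M) / q ≤ 6 * φ (n + M) :=
        div_le_self (by positivity) (by exact_mod_cast hq.1.1)
      linarith
    refine (Finset.sum_le_sum h1).trans ?_
    rw [Finset.sum_const, nsmul_eq_mul, ← ENNReal.ofReal_natCast, ← ENNReal.ofReal_mul (by positivity)]
    apply ENNReal.ofReal_le_ofReal
    have h2 := hM (n + M) (by omega)
    calc (A.card : ℝ) * (φ (n + M) * (4 * R + 6)) ≤
        (C * (2 ^ (n + M) : ℕ) * (φ (n + M)) ^ l) * (φ (n + M) * (4 * R + 6)) := by gcongr
      _ = _ := by push_cast; ring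
  filter_upwards [ae_all_iff.2 key] with y hy
  obtain ⟨R, hR⟩ := exists_nat_ge |y|
  rw [abs_le] at hR
  obtain ⟨n0, hn0⟩ := eventually_atTop.1 (hy R)
  refine eventually_atTop.2 ⟨n0 + M, fun n hn hex => ?_⟩
  have := hn0 (n - M) (by omega)
  rw [Nat.sub_add_cancel (by omega)] at this
  exact this ⟨hR, hex⟩

lemma exists_beta (l : ℕ) (τ : ℝ) (hτ : 0 < τ) (hτl : τ < l + 1) :
    ∃ β : ℝ, 0 < β ∧ β < 1 ∧ 2 * β ^ (l + 1) < 1 ∧ 1 < 2 * β ^ τ := by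
  obtain ⟨s, h1, h2⟩ := exists_between hτl
  have hs : 0 < s := hτ.trans h1
  refine ⟨(1 / 2 : ℝ) ^ (1 / s), by positivity,
    Real.rpow_lt_one (by norm_num) (by norm_num) (by positivity), ?_, ?_⟩
  · rw [← Real.rpow_natCast, ← Real.rpow_mul (by norm_num)]
    have h : (1 / 2 : ℝ) ^ (1 / s * ((l + 1 : ℕ) : ℝ)) < (1 / 2 : ℝ) ^ (1 : ℝ) := by
      apply Real.rpow_lt_rpow_of_exponent_gt (by norm_num) (by norm_num)
      rw [one_div_mul_eq_div, lt_div_iff₀ hs]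
      push_cast; linarith
    rw [Real.rpow_one] at h
    linarith
  · rw [← Real.rpow_mul (by norm_num)]
    have h : (1 / 2 : ℝ) ^ (1 : ℝ) < (1 / 2 : ℝ) ^ (1 / s * τ) := by
      apply Real.rpow_lt_rpow_of_exponent_gt (by norm_num) (by norm_num)
      rw [one_div_mul_eq_div, div_lt_iff₀ hs]
      linarith
    rw [Real.rpow_one] at h
    linarith

lemma distInt_lt {l : ℕ} (x : Fin l → ℝ) (y : ℝ) (q : ℕ) (r : ℝ) (hr : 0 < r) (h : Nr x q r)
    (p : ℤ) (hp : |(q : ℝ) * y - p| < r) :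
    distInt (fun i : Fin (l + 1) => (q : ℝ) * (Fin.snoc x y : Fin (l + 1) → ℝ) i) < r := by
  choose P hP using h
  let P' : Fin (l + 1) → ℤ := Fin.snoc P p
  refine lt_of_le_of_lt (ciInf_le ⟨0, by rintro _ ⟨p, rfl⟩; positivity⟩ P') ?_
  rw [pi_norm_lt_iff hr]
  intro i
  rw [Real.norm_eq_abs]
  refine Fin.lastCases ?_ (fun j => ?_) i
  · simpa [P'] using hp
  · simpa [P'] using hP j

theorem stmt_16 (l d : ℕ) (hd : d = l + 1) (hd2 : 2 ≤ d) (x : Fin l → ℝ)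
    (htype : tauD x < (d : ℝ≥0∞))
    (ψ : ℕ → ℝ) (hψpos : ∀ q, 0 < ψ q) (hψmono : Antitone ψ)
    (hdiv : ¬ Summable fun q : ℕ => ψ q ^ d) :
    ∀ᵐ y : ℝ, ∃ᶠ q : ℕ in atTop,
      distInt (fun i : Fin (l + 1) => (q : ℝ) * (Fin.snoc x y : Fin (l + 1) → ℝ) i) < ψ q := by
  subst hd
  obtain ⟨τ, c, hτ, hτl, hτd, hc, hc1, hH⟩ := type_bound l x htype
  obtain ⟨C, hC, hcount⟩ := count_le (by omega) x τ c hτ hc hH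
  obtain ⟨β, hβ, hβ1, hβd, hβτ⟩ := exists_beta l τ hτ hτd
  obtain ⟨κ, hκ⟩ := pow_unbounded_of_one_lt (12 * 2 ^ (l + 1) * C) (one_lt_two (α := ℝ))
  set δ : ℕ → ℝ := fun n => max (min (ψ (2 ^ n)) 1) (β ^ n) with hδdef
  have hδβ : ∀ n, β ^ n ≤ δ n := fun n => le_max_right _ _
  have hδ0 : ∀ n, 0 < δ n := fun n => (pow_pos hβ n).trans_le (hδβ n)
  have hβn1 : ∀ n, β ^ n ≤ 1 := fun n => pow_le_one₀ hβ.le hβ1.le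
  have hδ1 : ∀ n, δ n ≤ 1 := fun n => max_le (min_le_right _ _) (hβn1 n)
  have hδa : Antitone δ := by
    intro m n hmn
    have h1 : ψ (2 ^ n) ≤ ψ (2 ^ m) := hψmono (Nat.pow_le_pow_right (by norm_num) hmn)
    have h2 : β ^ n ≤ β ^ m := pow_le_pow_of_le_one hβ.le hβ1.le hmn
    exact max_le_max (min_le_min h1 le_rfl) h2
  have hbig : Tendsto (fun n : ℕ => (2 * β ^ τ) ^ n) atTop atTop := tendsto_pow_atTop_atTop_of_one_lt hβτ
  have hcond : ∀ k : ℕ, ∀ᶠ n : ℕ in atTop, ∀ u : ℝ, β ^ n ≤ u →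
      1 ≤ 6 * c * (2 ^ (n - k) : ℕ) * u ^ τ := by
    intro k
    filter_upwards [hbig.eventually_ge_atTop (2 ^ k / (6 * c)), eventually_ge_atTop k] with n hn hk u hu
    rw [div_le_iff₀ (by positivity)] at hn
    have h1 : (β ^ τ) ^ n ≤ u ^ τ := by
      rw [← Real.rpow_natCast, ← Real.rpow_mul hβ.le, mul_comm, Real.rpow_mul hβ.le, Real.rpow_natCast]
      exact Real.rpow_le_rpow (by positivity) hu hτ.le
    have h2 : (2 : ℝ) ^ n = 2 ^ (n - k) * 2 ^ k := by rw [← pow_add, Nat.sub_add_cancel hk]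
    rw [mul_pow, h2] at hn
    have h3 : 2 ^ k * 1 ≤ 2 ^ k * (6 * c * (2 : ℝ) ^ (n - k) * (β ^ τ) ^ n) := by linarith
    have h4 := le_of_mul_le_mul_left h3 (by positivity)
    push_cast
    refine h4.trans ?_
    gcongr
  have hN : ∀ᶠ n : ℕ in atTop, (((Finset.Icc 1 (2 ^ (n - κ))).filter fun q => Nr x q (δ n)).card : ℝ) ≤
      C * (2 ^ (n - κ) : ℕ) * (δ n) ^ l := by
    filter_upwards [hcond κ] with n hn
    exact hcount _ _ Nat.one_le_two_pow (hδ0 n) (hn _ (hδβ n))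
  have hN2 : ∀ᶠ n : ℕ in atTop, (((Finset.Icc 1 (2 ^ n)).filter fun q => Nr x q (β ^ n)).card : ℝ) ≤
      C * (2 ^ n : ℕ) * (β ^ n) ^ l := by
    filter_upwards [hcond 0] with n hn
    exact hcount _ _ Nat.one_le_two_pow (pow_pos hβ n) (hn _ le_rfl)
  have hη : Tendsto (fun n => 2 ^ (l + 1) / ((2 : ℝ) ^ n * δ n ^ l)) atTop (nhds 0) := by
    have h1 : Tendsto (fun n : ℕ => 2 ^ (l + 1) / (2 * β ^ τ) ^ n) atTop (nhds 0) :=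
      hbig.const_div_atTop _
    refine squeeze_zero (fun n => by have := hδ0 n; positivity) (fun n => ?_) h1
    have h2 : (β ^ τ) ^ n ≤ δ n ^ l := by
      have h3 : β ^ τ ≤ β ^ l := by
        rw [← Real.rpow_natCast]
        exact Real.rpow_le_rpow_of_exponent_ge hβ hβ1.le hτl
      calc (β ^ τ) ^ n ≤ (β ^ l) ^ n := by gcongr
        _ = (β ^ n) ^ l := by rw [← pow_mul, ← pow_mul, mul_comm]
        _ ≤ δ n ^ l := by have := hδβ n; gcongr
    rw [mul_pow]
    gcongr
  have hdiv2 : ¬ Summable fun n => (2 : ℝ) ^ n * δ n ^ (l + 1) := by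
    intro hs
    apply hdiv
    rw [← summable_condensed_iff_of_nonneg (fun n => by have := hψpos n; positivity)
      (fun m n _ hmn => by
        have := hψpos n
        have := hψmono hmn
        gcongr)]
    have hlt : ∀ᶠ n : ℕ in atTop, (2 : ℝ) ^ n * δ n ^ (l + 1) < 1 :=
      hs.tendsto_atTop_zero.eventually_lt_const (by norm_num)
    refine Summable.of_norm_bounded_eventually_nat hs ?_
    filter_upwards [hlt] with n hn
    have hψ1 : ψ (2 ^ n) ≤ δ n := by
      by_cases h : ψ (2 ^ n) ≤ 1
      · have : min (ψ (2 ^ n)) 1 = ψ (2 ^ n) := min_eq_left h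
        calc ψ (2 ^ n) = min (ψ (2 ^ n)) 1 := this.symm
          _ ≤ _ := le_max_left _ _
      · exfalso
        push Not at h
        have h1 : 1 ≤ δ n := by
          calc (1 : ℝ) = min (ψ (2 ^ n)) 1 := (min_eq_right h.le).symm
            _ ≤ _ := le_max_left _ _
        have h2 : 1 ≤ δ n ^ (l + 1) := one_le_pow₀ h1
        have h3 : (1 : ℝ) ≤ 2 ^ n := one_le_pow₀ (by norm_num)
        nlinarith
    have := hψpos (2 ^ n)
    rw [Real.norm_of_nonneg (by positivity)]
    gcongr
  have hsum : Summable fun n => (2 : ℝ) ^ n * (β ^ n) ^ (l + 1) := by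
    refine (summable_geometric_of_lt_one (r := 2 * β ^ (l + 1)) (by positivity) hβd).congr fun n => ?_
    rw [mul_pow, ← pow_mul, ← pow_mul, mul_comm n]
  have D := ae_all_iff.2 (divergence x κ C hκ.le δ hδ0 hδ1 hδa hN hη hdiv2)
  have E := convergence x C (fun n => β ^ n) (fun n => pow_pos hβ n) hβn1 hN2 hsum
  filter_upwards [D, E] with y hD hE
  rw [frequently_atTop]
  intro q1
  obtain ⟨n1, hn1⟩ := eventually_atTop.1 hE
  obtain ⟨n, hn, q, hq1, hq2, hq3, hq4, p, hp⟩ := hD (max n1 (q1 + κ))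
  have hnn1 : n1 ≤ n := (le_max_left _ _).trans hn
  have hnq : q1 + κ ≤ n := (le_max_right _ _).trans hn
  refine ⟨q, ?_, ?_⟩
  · have h1 : 2 ^ (q1 + κ) < q * 2 ^ κ := (Nat.pow_le_pow_right (by norm_num) hnq).trans_lt hq2
    rw [pow_add] at h1
    have h2 := Nat.lt_of_mul_lt_mul_right h1
    have h3 : q1 < 2 ^ q1 := Nat.lt_two_pow_self
    omega
  · have hno := hn1 n hnn1
    have hcase : δ n = min (ψ (2 ^ n)) 1 := by
      rcases max_choice (min (ψ (2 ^ n)) 1) (β ^ n) with h | h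
      · exact h
      · exfalso
        have h' : δ n = β ^ n := h
        rw [h'] at hq4 hp
        exact hno ⟨q, hq1, hq3, hq4, p, hp⟩
    have hle : δ n ≤ ψ q := by
      rw [hcase]
      exact (min_le_left _ _).trans (hψmono hq3)
    exact (distInt_lt x y q (δ n) (hδ0 n) hq4 p hp).trans_le hle
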